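/- For every τ ∈ ℝ^ℓ, writing τ̃ := Φ⁻¹(τ), the determinant of the Jacobian matrix (∂J_j/∂τ_i)(τ) equals ∏_{j=1}^ℓ ( l_j − L_j(τ) ) · 𝒥′(τ̃_j), where 𝒥′(t) = 2e^{2t}/(1 + e^{2t})² is the derivative of 𝒥. -/

import Mathlib

open Real Finset

noncomputable section

/-- `K(t) = log(1 + e^{2t})`. -/
def Kfun (t : ℝ) : ℝ := Real.log (1 + Real.exp (2 * t))

/-- `𝒥(t) = e^{2t}/(1 + e^{2t})`. -/
def Jfun (t : ℝ) : ℝ := Real.exp (2 * t) / (1 + Real.exp (2 * t))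

/-- The coordinate change `Φ(σ)_i = σ_i + (1/2)·Σ_{j>i} c_{ji} K(σ_j)`. -/
def Phi {ℓ : ℕ} (c : Fin ℓ → Fin ℓ → ℤ) (σ : Fin ℓ → ℝ) : Fin ℓ → ℝ :=
  fun i => σ i + (1 / 2) * ∑ j ∈ Finset.univ.filter (fun j => i < j), (c j i : ℝ) * Kfun (σ j)

/-- The inverse of the coordinate change `Φ`. -/
def PhiInv {ℓ : ℕ} (c : Fin ℓ → Fin ℓ → ℤ) : (Fin ℓ → ℝ) → (Fin ℓ → ℝ) :=
  Function.invFun (Phi c)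

/-- The Kähler potential `K_λ(τ) = Σ_i l_i K(τ̃_i)`, where `τ̃ = Φ⁻¹(τ)`. -/
def Klam {ℓ : ℕ} (l : Fin ℓ → ℤ) (c : Fin ℓ → Fin ℓ → ℤ) (τ : Fin ℓ → ℝ) : ℝ :=
  ∑ i, (l i : ℝ) * Kfun (PhiInv c τ i)

/-- The action variables `J_j(τ) = (1/2)·∂K_λ/∂τ_j`. -/
def Jact {ℓ : ℕ} (l : Fin ℓ → ℤ) (c : Fin ℓ → Fin ℓ → ℤ) (j : Fin ℓ) (τ : Fin ℓ → ℝ) : ℝ :=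
  (1 / 2) * fderiv ℝ (Klam l c) τ (Pi.single j 1)

/-- `L_j(τ) = Σ_{i<j} c_{ji} J_i(τ)`. -/
def Lfun {ℓ : ℕ} (l : Fin ℓ → ℤ) (c : Fin ℓ → Fin ℓ → ℤ) (j : Fin ℓ) (τ : Fin ℓ → ℝ) : ℝ :=
  ∑ i ∈ Finset.univ.filter (fun i => i < j), (c j i : ℝ) * Jact l c i τ

/-- Explicit recursive inverse of `Phi`. -/
def invRec {ℓ : ℕ} (c : Fin ℓ → Fin ℓ → ℤ) (τ : Fin ℓ → ℝ) (i : Fin ℓ) : ℝ :=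
  τ i - (1 / 2) * ∑ j : {j : Fin ℓ // i < j}, (c j.1 i : ℝ) * Kfun (invRec c τ j.1)
termination_by ℓ - i.1
decreasing_by
  have h1 := j.2
  have h2 := j.1.2
  simp only [Fin.lt_def] at h1
  omega

theorem Phi_invRec {ℓ : ℕ} (c : Fin ℓ → Fin ℓ → ℤ) (τ : Fin ℓ → ℝ) :
    Phi c (invRec c τ) = τ := by
  funext i
  unfold Phi
  rw [invRec]
  rw [Finset.sum_subtype (p := fun j => i < j) (Finset.univ.filter (fun j => i < j))
    (by simp) (fun j => (c j i : ℝ) * Kfun (invRec c τ j))]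
  ring

theorem Phi_PhiInv {ℓ : ℕ} (c : Fin ℓ → Fin ℓ → ℤ) (τ : Fin ℓ → ℝ) :
    Phi c (PhiInv c τ) = τ :=
  Function.invFun_eq ⟨_, Phi_invRec c τ⟩

theorem PhiInv_eq {ℓ : ℕ} (c : Fin ℓ → Fin ℓ → ℤ) (τ : Fin ℓ → ℝ) (i : Fin ℓ) :
    PhiInv c τ i + (1 / 2) * ∑ j ∈ Finset.univ.filter (fun j => i < j),
      (c j i : ℝ) * Kfun (PhiInv c τ j) = τ i :=
  congrFun (Phi_PhiInv c τ) i

theorem hasDerivAt_Kfun (t : ℝ) : HasDerivAt Kfun (2 * Jfun t) t := by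
  have h0 : HasDerivAt (fun t : ℝ => 2 * t) 2 t := by
    simpa using (hasDerivAt_id t).const_mul 2
  have h := (h0.exp.const_add 1).log (by positivity)
  have e : Real.exp (2 * t) * 2 / (1 + Real.exp (2 * t)) = 2 * Jfun t := by
    unfold Jfun
    ring
  rw [e] at h
  exact h

theorem hasDerivAt_Jfun (t : ℝ) :
    HasDerivAt Jfun (2 * Real.exp (2 * t) / (1 + Real.exp (2 * t)) ^ 2) t := by
  have h0 : HasDerivAt (fun t : ℝ => 2 * t) 2 t := by
    simpa using (hasDerivAt_id t).const_mul 2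
  have h := h0.exp.div (h0.exp.const_add 1) (by positivity)
  have e : (Real.exp (2 * t) * 2 * (1 + Real.exp (2 * t)) -
      Real.exp (2 * t) * (Real.exp (2 * t) * 2)) / (1 + Real.exp (2 * t)) ^ 2 =
      2 * Real.exp (2 * t) / (1 + Real.exp (2 * t)) ^ 2 := by
    congr 1
    ring
  rw [e] at h
  exact h

theorem differentiable_PhiInv {ℓ : ℕ} (c : Fin ℓ → Fin ℓ → ℤ) (i : Fin ℓ) :
    Differentiable ℝ (fun τ => PhiInv c τ i) := by
  induction i using WellFoundedGT.induction with
  | ind i ih =>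
    have : (fun τ => PhiInv c τ i) = fun τ : Fin ℓ → ℝ =>
        τ i - (1 / 2) * ∑ j ∈ Finset.univ.filter (fun j => i < j),
          (c j i : ℝ) * Kfun (PhiInv c τ j) := by
      funext τ
      linarith [PhiInv_eq c τ i]
    rw [this]
    have hK : Differentiable ℝ Kfun := fun t => (hasDerivAt_Kfun t).differentiableAt
    refine Differentiable.sub (by fun_prop) (Differentiable.const_mul ?_ _)
    refine Differentiable.fun_sum fun j hj => Differentiable.const_mul ?_ _
    exact hK.comp (ih j (by simpa using hj))

/-- Jacobian of `Phi`. -/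
def Umat {ℓ : ℕ} (c : Fin ℓ → Fin ℓ → ℤ) (τ : Fin ℓ → ℝ) : Matrix (Fin ℓ) (Fin ℓ) ℝ :=
  Matrix.of fun m k => (if m = k then 1 else 0) +
    if m < k then (c k m : ℝ) * Jfun (PhiInv c τ k) else 0

/-- Transposed Jacobian of `PhiInv`. -/
def Smat {ℓ : ℕ} (c : Fin ℓ → Fin ℓ → ℤ) (τ : Fin ℓ → ℝ) : Matrix (Fin ℓ) (Fin ℓ) ℝ :=
  Matrix.of fun i k => fderiv ℝ (fun τ => PhiInv c τ k) τ (Pi.single i 1)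

theorem det_Umat {ℓ : ℕ} (c : Fin ℓ → Fin ℓ → ℤ) (τ : Fin ℓ → ℝ) : (Umat c τ).det = 1 := by
  rw [Matrix.det_of_upperTriangular]
  · simp [Umat]
  · intro i j hij
    have hij' : j < i := hij
    simp [Umat, hij'.ne', hij'.not_gt]

theorem hasFDerivAt_K {ℓ : ℕ} (c : Fin ℓ → Fin ℓ → ℤ) (τ : Fin ℓ → ℝ) (j : Fin ℓ) :
    HasFDerivAt (fun τ => Kfun (PhiInv c τ j))
      ((2 * Jfun (PhiInv c τ j)) • fderiv ℝ (fun τ => PhiInv c τ j) τ) τ :=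
  HasDerivAt.comp_hasFDerivAt (h₂ := Kfun) (f := fun τ => PhiInv c τ j) τ
    (hasDerivAt_Kfun (PhiInv c τ j))
    (differentiable_PhiInv c j τ).hasFDerivAt

theorem Smat_mul {ℓ : ℕ} (c : Fin ℓ → Fin ℓ → ℤ) (τ : Fin ℓ → ℝ) :
    Smat c τ * (Umat c τ).transpose = 1 := by
  ext i k
  have h1 := ((differentiable_PhiInv c k τ).hasFDerivAt).add
    ((HasFDerivAt.fun_sum (u := Finset.univ.filter (fun j => k < j))
      fun j _ => (hasFDerivAt_K c τ j).const_mul (c j k : ℝ)).const_mul (1 / 2 : ℝ))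
  have h2 : HasFDerivAt (fun τ : Fin ℓ → ℝ => τ k)
      (ContinuousLinearMap.proj (R := ℝ) (φ := fun _ : Fin ℓ => ℝ) k) τ :=
    hasFDerivAt_apply k τ
  have h3 := h1.congr_of_eventuallyEq
    (Filter.Eventually.of_forall fun τ => (PhiInv_eq c τ k).symm)
  have h4 := DFunLike.congr_fun (h3.unique h2) (Pi.single i 1)
  simp only [ContinuousLinearMap.add_apply, ContinuousLinearMap.smul_apply,
    ContinuousLinearMap.sum_apply, ContinuousLinearMap.proj_apply, smul_eq_mul] at h4
  rw [Matrix.mul_apply, Matrix.one_apply]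
  simp only [Smat, Umat, Matrix.of_apply, Matrix.transpose_apply, mul_add, mul_ite, mul_one,
    mul_zero, Finset.sum_add_distrib]
  rw [Finset.sum_ite_eq, if_pos (Finset.mem_univ _), ← Finset.sum_filter]
  rw [Pi.single_apply] at h4
  simp only [eq_comm (a := i)]
  rw [← h4, Finset.mul_sum]
  congr 1
  refine Finset.sum_congr rfl fun j _ => ?_
  ring

theorem Jact_eq_S {ℓ : ℕ} (l : Fin ℓ → ℤ) (c : Fin ℓ → Fin ℓ → ℤ) (τ : Fin ℓ → ℝ) :
    (fun k => Jact l c k τ) = (Smat c τ).mulVec (fun k => (l k : ℝ) * Jfun (PhiInv c τ k)) := by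
  funext k
  have h1 : HasFDerivAt (Klam l c) _ τ := HasFDerivAt.fun_sum (u := Finset.univ)
      fun j _ => (hasFDerivAt_K c τ j).const_mul (l j : ℝ)
  unfold Jact
  rw [h1.fderiv]
  simp only [ContinuousLinearMap.smul_apply,
    ContinuousLinearMap.sum_apply, smul_eq_mul, Matrix.mulVec, dotProduct, Smat, Matrix.of_apply]
  rw [Finset.mul_sum]
  refine Finset.sum_congr rfl fun j _ => ?_
  ring

theorem Jact_rec {ℓ : ℕ} (l : Fin ℓ → ℤ) (c : Fin ℓ → Fin ℓ → ℤ) (k : Fin ℓ) (τ : Fin ℓ → ℝ) :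
    Jact l c k τ = ((l k : ℝ) - Lfun l c k τ) * Jfun (PhiInv c τ k) := by
  have h : (Umat c τ).transpose.mulVec (fun k => Jact l c k τ) =
      fun k => (l k : ℝ) * Jfun (PhiInv c τ k) := by
    rw [Jact_eq_S, Matrix.mulVec_mulVec, mul_eq_one_comm.mp (Smat_mul c τ), Matrix.one_mulVec]
  have h' := congrFun h k
  simp only [Matrix.mulVec, dotProduct, Umat, Matrix.of_apply, Matrix.transpose_apply, add_mul,
    ite_mul, one_mul, zero_mul, Finset.sum_add_distrib] at h'
  rw [Finset.sum_ite_eq', if_pos (Finset.mem_univ _), ← Finset.sum_filter] at h'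
  rw [sub_mul, ← h', Lfun, Finset.sum_mul, eq_sub_iff_add_eq]
  congr 1
  refine Finset.sum_congr rfl fun j _ => ?_
  ring

theorem hasFDerivAt_J {ℓ : ℕ} (c : Fin ℓ → Fin ℓ → ℤ) (τ : Fin ℓ → ℝ) (j : Fin ℓ) :
    HasFDerivAt (fun τ => Jfun (PhiInv c τ j))
      ((2 * Real.exp (2 * PhiInv c τ j) / (1 + Real.exp (2 * PhiInv c τ j)) ^ 2) •
        fderiv ℝ (fun τ => PhiInv c τ j) τ) τ :=
  HasDerivAt.comp_hasFDerivAt (h₂ := Jfun) (f := fun τ => PhiInv c τ j) τ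
    (hasDerivAt_Jfun (PhiInv c τ j))
    (differentiable_PhiInv c j τ).hasFDerivAt

theorem differentiable_Jact {ℓ : ℕ} (l : Fin ℓ → ℤ) (c : Fin ℓ → Fin ℓ → ℤ) (k : Fin ℓ) :
    Differentiable ℝ (Jact l c k) := by
  induction k using WellFoundedLT.induction with
  | ind k ih =>
    rw [show Jact l c k = _ from funext (Jact_rec l c k)]
    refine Differentiable.mul (Differentiable.const_sub ?_ _)
      fun τ => (hasFDerivAt_J c τ k).differentiableAt
    unfold Lfun
    exact Differentiable.fun_sum fun j hj => (ih j (by simpa using hj)).const_mul _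

theorem Amat_mul {ℓ : ℕ} (l : Fin ℓ → ℤ) (c : Fin ℓ → Fin ℓ → ℤ) (τ : Fin ℓ → ℝ) :
    (Matrix.of fun i j : Fin ℓ => fderiv ℝ (Jact l c j) τ (Pi.single i 1)) * Umat c τ =
      Smat c τ * Matrix.diagonal fun j => ((l j : ℝ) - Lfun l c j τ) *
        (2 * Real.exp (2 * PhiInv c τ j) / (1 + Real.exp (2 * PhiInv c τ j)) ^ 2) := by
  ext i k
  have hL : HasFDerivAt (Lfun l c k) _ τ := HasFDerivAt.fun_sum
    (u := Finset.univ.filter (fun i => i < k))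
    fun j _ => ((differentiable_Jact l c j τ).hasFDerivAt).const_mul (c k j : ℝ)
  have h1 := (hL.const_sub (l k : ℝ)).mul (hasFDerivAt_J c τ k)
  have h3 := h1.congr_of_eventuallyEq
    (Filter.Eventually.of_forall fun τ => (Jact_rec l c k τ))
  have h4 := DFunLike.congr_fun h3.fderiv (Pi.single i 1)
  simp only [ContinuousLinearMap.add_apply, ContinuousLinearMap.smul_apply,
    ContinuousLinearMap.neg_apply,
    ContinuousLinearMap.sum_apply, smul_eq_mul] at h4
  rw [Matrix.mul_diagonal, Matrix.mul_apply]
  simp only [Smat, Umat, Matrix.of_apply, mul_add, mul_ite, mul_one,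
    mul_zero, Finset.sum_add_distrib]
  rw [Finset.sum_ite_eq', if_pos (Finset.mem_univ _), ← Finset.sum_filter]
  have h5 : ∑ j ∈ Finset.univ.filter (fun j => j < k),
      fderiv ℝ (Jact l c j) τ (Pi.single i 1) * ((c k j : ℝ) * Jfun (PhiInv c τ k)) =
      Jfun (PhiInv c τ k) * ∑ j ∈ Finset.univ.filter (fun j => j < k),
        (c k j : ℝ) * fderiv ℝ (Jact l c j) τ (Pi.single i 1) := by
    rw [Finset.mul_sum]
    refine Finset.sum_congr rfl fun j _ => ?_
    ring
  rw [h5, h4]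
  ring

/-- Lemma 6.2 (determinant identity): writing `τ̃ = Φ⁻¹(τ)`, the Jacobian
determinant `det(∂J_j/∂τ_i)` equals `∏_j (l_j − L_j(τ))·𝒥′(τ̃_j)`, where
`𝒥′(t) = 2e^{2t}/(1+e^{2t})²`. -/
theorem jacobian_determinant_of_action_variables {ℓ : ℕ} (l : Fin ℓ → ℤ)
    (c : Fin ℓ → Fin ℓ → ℤ) (τ : Fin ℓ → ℝ) :
    (Matrix.of fun i j : Fin ℓ => fderiv ℝ (Jact l c j) τ (Pi.single i 1)).det =
      ∏ j : Fin ℓ, ((l j : ℝ) - Lfun l c j τ) *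
        (2 * Real.exp (2 * PhiInv c τ j) / (1 + Real.exp (2 * PhiInv c τ j)) ^ 2) := by
  have hA := congrArg Matrix.det (Amat_mul l c τ)
  have hS := congrArg Matrix.det (Smat_mul c τ)
  rw [Matrix.det_mul, Matrix.det_transpose, det_Umat, mul_one, Matrix.det_one] at hS
  rw [Matrix.det_mul, Matrix.det_mul, det_Umat, mul_one, hS, one_mul, Matrix.det_diagonal] at hA
  exact hA
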